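/- arXiv:1711.08517 — 11 statements merged into one kernel-verified Lean document; each statement's English description precedes it below -/
import Mathlib

section
/- Suppose x_k⁽¹⁾ ≠ 0, t_k > 0 and x_{k+1} = x_k + t_k·d_k. Then the following are equivalent: (i) the Wolfe condition W(t_k) holds; (ii) sgn(x_{k+1}⁽¹⁾) = −sgn(x_k⁽¹⁾) (in particular x_{k+1}⁽¹⁾ ≠ 0); (iii) t_k > |x_k⁽¹⁾|/a; (iv) a·t_k = |x_k⁽¹⁾| + |x_{k+1}⁽¹⁾| and x_{k+1}⁽¹⁾ ≠ 0. -/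
/-- The index of the first coordinate of `ℝⁿ` (requires `n ≥ 2`). -/
def firstIdx {n : ℕ} (hn : 2 ≤ n) : Fin n := ⟨0, by omega⟩

/-- The objective function `f(x) = a|x⁽¹⁾| + ∑_{i=2}^n x⁽ⁱ⁾` on `ℝⁿ`. -/
noncomputable def objF {n : ℕ} (hn : 2 ≤ n) (a : ℝ) (x : EuclideanSpace ℝ (Fin n)) : ℝ :=
  a * |x (firstIdx hn)| + ∑ i ∈ Finset.univ.erase (firstIdx hn), x i

/-- The gradient vector `∇f(x) = (sgn(x⁽¹⁾)·a, 1, …, 1)` of `f` at a point `x`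
(meaningful when `x⁽¹⁾ ≠ 0`); here `Real.sign u = 1` if `u > 0` and `-1` if `u < 0`. -/
noncomputable def gradF {n : ℕ} (hn : 2 ≤ n) (a : ℝ) (x : EuclideanSpace ℝ (Fin n)) :
    EuclideanSpace ℝ (Fin n) :=
  (EuclideanSpace.equiv (Fin n) ℝ).symm
    (fun i => if i = firstIdx hn then Real.sign (x (firstIdx hn)) * a else 1)

/-- The steepest-descent search direction `d = −∇f(x)`. -/
noncomputable def dir {n : ℕ} (hn : 2 ≤ n) (a : ℝ) (x : EuclideanSpace ℝ (Fin n)) :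
    EuclideanSpace ℝ (Fin n) := -(gradF hn a x)

/-- The Armijo condition `A(t)`:
`f(x + t·d) ≤ f(x) − c₁·t·(a² + n − 1)` where `d = −∇f(x)`. -/
def armijo {n : ℕ} (hn : 2 ≤ n) (a c₁ : ℝ) (x : EuclideanSpace ℝ (Fin n)) (t : ℝ) : Prop :=
  objF hn a (x + t • dir hn a x) ≤ objF hn a x - c₁ * t * (a ^ 2 + ((n : ℝ) - 1))

/-- The Wolfe condition `W(t)`: `f` is differentiable at `x + t·d` and
`⟨∇f(x + t·d), d⟩ ≥ −c₂·(a² + n − 1)` where `d = −∇f(x)`. -/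
noncomputable def wolfe {n : ℕ} (hn : 2 ≤ n) (a c₂ : ℝ) (x : EuclideanSpace ℝ (Fin n))
    (t : ℝ) : Prop :=
  DifferentiableAt ℝ (objF hn a) (x + t • dir hn a x) ∧
    (inner ℝ (gradient (objF hn a) (x + t • dir hn a x)) (dir hn a x) : ℝ) ≥
      -c₂ * (a ^ 2 + ((n : ℝ) - 1))

/-- `τ = c₁ + (n − 1)(c₁ − 1)/a²`. -/
noncomputable def tauP (n : ℕ) (a c₁ : ℝ) : ℝ := c₁ + ((n : ℝ) - 1) * (c₁ - 1) / a ^ 2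

lemma sign_cases_aux {u : ℝ} (h : u ≠ 0) :
    (0 < u ∧ Real.sign u = 1) ∨ (u < 0 ∧ Real.sign u = -1) := by
  rcases lt_or_gt_of_ne h with h | h
  · exact Or.inr ⟨h, Real.sign_of_neg h⟩
  · exact Or.inl ⟨h, Real.sign_of_pos h⟩

lemma hasDerivAt_abs_aux {u : ℝ} (h : u ≠ 0) : HasDerivAt (fun y : ℝ => |y|) (Real.sign u) u := by
  rcases sign_cases_aux h with ⟨h, h'⟩ | ⟨h, h'⟩
  · rw [h']; exact hasDerivAt_abs_pos h
  · rw [h']; exact hasDerivAt_abs_neg h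

lemma objF_hasFDerivAt {n : ℕ} (hn : 2 ≤ n) (a : ℝ) (z : EuclideanSpace ℝ (Fin n))
    (hz : z (firstIdx hn) ≠ 0) :
    HasFDerivAt (objF hn a)
      (a • (Real.sign (z (firstIdx hn)) • EuclideanSpace.proj (𝕜 := ℝ) (firstIdx hn)) +
        ∑ i ∈ Finset.univ.erase (firstIdx hn),
          (EuclideanSpace.proj (𝕜 := ℝ) i : EuclideanSpace ℝ (Fin n) →L[ℝ] ℝ)) z := by
  have hp : ∀ i : Fin n, HasFDerivAt (fun x : EuclideanSpace ℝ (Fin n) => x i)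
      (EuclideanSpace.proj (𝕜 := ℝ) i : EuclideanSpace ℝ (Fin n) →L[ℝ] ℝ) z := fun i =>
    (EuclideanSpace.proj (𝕜 := ℝ) i : EuclideanSpace ℝ (Fin n) →L[ℝ] ℝ).hasFDerivAt
  have h1 := ((hasDerivAt_abs_aux hz).comp_hasFDerivAt z (hp (firstIdx hn))).const_mul a
  have h2 := HasFDerivAt.fun_sum (u := Finset.univ.erase (firstIdx hn)) (fun i _ => hp i)
  exact h1.add h2

lemma objF_not_diff {n : ℕ} (hn : 2 ≤ n) (a : ℝ) (ha : 0 < a) (z : EuclideanSpace ℝ (Fin n))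
    (hz : z (firstIdx hn) = 0) : ¬ DifferentiableAt ℝ (objF hn a) z := by
  intro hd
  set e : EuclideanSpace ℝ (Fin n) := EuclideanSpace.single (firstIdx hn) (1 : ℝ) with he
  have hg : DifferentiableAt ℝ (fun s : ℝ => z + s • e) 0 := by fun_prop
  have hc : DifferentiableAt ℝ (fun s : ℝ => objF hn a (z + s • e)) 0 := by
    refine DifferentiableAt.comp (g := objF hn a) (0 : ℝ) ?_ hg
    simpa using hd
  have hf : (fun s : ℝ => objF hn a (z + s • e)) =
      fun s => a * |s| + ∑ i ∈ Finset.univ.erase (firstIdx hn), z i := by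
    funext s
    unfold objF
    congr 1
    · simp [he, hz]
    · refine Finset.sum_congr rfl fun i hi => ?_
      have := Finset.ne_of_mem_erase hi
      simp [he, this]
  rw [hf] at hc
  apply not_differentiableAt_abs_zero
  have h3 := (hc.sub_const (∑ i ∈ Finset.univ.erase (firstIdx hn), z i)).const_mul a⁻¹
  refine h3.congr_of_eventuallyEq (Filter.Eventually.of_forall fun s => ?_)
  simp [ha.ne']

lemma dir_first {n : ℕ} (hn : 2 ≤ n) (a : ℝ) (x : EuclideanSpace ℝ (Fin n)) :
    dir hn a x (firstIdx hn) = -(Real.sign (x (firstIdx hn)) * a) := by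
  simp [dir, gradF]

lemma dir_other {n : ℕ} (hn : 2 ≤ n) (a : ℝ) (x : EuclideanSpace ℝ (Fin n)) (i : Fin n)
    (hi : i ≠ firstIdx hn) : dir hn a x i = -1 := by
  simp [dir, gradF, hi]

lemma inner_aux {n : ℕ} (hn : 2 ≤ n) (a : ℝ) (x z : EuclideanSpace ℝ (Fin n))
    (hz : z (firstIdx hn) ≠ 0) :
    (inner ℝ (gradient (objF hn a) z) (dir hn a x) : ℝ) =
      -(Real.sign (z (firstIdx hn)) * Real.sign (x (firstIdx hn)) * a ^ 2) - ((n : ℝ) - 1) := by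
  rw [inner_gradient_left, (objF_hasFDerivAt hn a z hz).fderiv]
  have hs : ∑ i ∈ Finset.univ.erase (firstIdx hn), dir hn a x i = -((n : ℝ) - 1) := by
    rw [Finset.sum_congr rfl fun i hi => dir_other hn a x i (Finset.ne_of_mem_erase hi)]
    simp [Finset.card_erase_of_mem, Nat.cast_sub (show 1 ≤ n by omega)]
  have : ((a • (Real.sign (z (firstIdx hn)) • EuclideanSpace.proj (𝕜 := ℝ) (firstIdx hn)) +
        ∑ i ∈ Finset.univ.erase (firstIdx hn),
          (EuclideanSpace.proj (𝕜 := ℝ) i : EuclideanSpace ℝ (Fin n) →L[ℝ] ℝ)) (dir hn a x)) =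
      a * (Real.sign (z (firstIdx hn)) * dir hn a x (firstIdx hn)) +
        ∑ i ∈ Finset.univ.erase (firstIdx hn), dir hn a x i := by
    simp
  rw [this, hs, dir_first]
  ring

lemma wolfe_iff {n : ℕ} (hn : 2 ≤ n) (a c₂ : ℝ) (ha : Real.sqrt ((n : ℝ) - 1) ≤ a)
    (hc₀ : 0 < c₂) (hc₂ : c₂ < 1)
    (xk : EuclideanSpace ℝ (Fin n)) (hxk : xk (firstIdx hn) ≠ 0) (tk : ℝ) :
    wolfe hn a c₂ xk tk ↔
      (Real.sign ((xk + tk • dir hn a xk) (firstIdx hn)) = -Real.sign (xk (firstIdx hn)) ∧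
        (xk + tk • dir hn a xk) (firstIdx hn) ≠ 0) := by
  have hn' : (2 : ℝ) ≤ n := by exact_mod_cast hn
  have ha0 : 0 < a := lt_of_lt_of_le (Real.sqrt_pos.2 (by linarith)) ha
  have ha2 : (n : ℝ) - 1 ≤ a ^ 2 := (Real.sqrt_le_left ha0.le).1 ha
  unfold wolfe
  generalize xk + tk • dir hn a xk = z
  by_cases hz : z (firstIdx hn) = 0
  · simp [hz, objF_not_diff hn a ha0 z hz]
  · rw [inner_aux hn a xk z hz]
    have hd := (objF_hasFDerivAt hn a z hz).differentiableAt
    have hpos : 0 < a ^ 2 + ((n : ℝ) - 1) := by nlinarith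
    have h1 := mul_pos hc₀ hpos
    have h2 := mul_pos (sub_pos.2 hc₂) hpos
    rcases sign_cases_aux hz with ⟨_, h⟩ | ⟨_, h⟩ <;>
    rcases sign_cases_aux hxk with ⟨_, h'⟩ | ⟨_, h'⟩ <;> rw [h, h'] <;>
    simp only [hd, hz, true_and, ne_eq, not_false_eq_true, and_true] <;>
    constructor <;> intro h3 <;> first | trivial | linarith

/-- equivalent characterizations of the Wolfe condition `W(t_k)`,
where `x_{k+1} = x_k + t_k·d_k`. -/
theorem stmt2 {n : ℕ} (hn : 2 ≤ n) (a c₁ c₂ : ℝ) (ha : Real.sqrt ((n : ℝ) - 1) ≤ a)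
    (hc₁ : 0 < c₁) (hc₁₂ : c₁ < c₂) (hc₂ : c₂ < 1)
    (xk : EuclideanSpace ℝ (Fin n)) (hxk : xk (firstIdx hn) ≠ 0)
    (tk : ℝ) (htk : 0 < tk) :
    (wolfe hn a c₂ xk tk ↔
      (Real.sign ((xk + tk • dir hn a xk) (firstIdx hn)) = -Real.sign (xk (firstIdx hn)) ∧
        (xk + tk • dir hn a xk) (firstIdx hn) ≠ 0)) ∧
    (wolfe hn a c₂ xk tk ↔ tk > |xk (firstIdx hn)| / a) ∧
    (wolfe hn a c₂ xk tk ↔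
      (a * tk = |xk (firstIdx hn)| + |(xk + tk • dir hn a xk) (firstIdx hn)| ∧
        (xk + tk • dir hn a xk) (firstIdx hn) ≠ 0)) := by
  have hn' : (2 : ℝ) ≤ n := by exact_mod_cast hn
  have ha0 : 0 < a := lt_of_lt_of_le (Real.sqrt_pos.2 (by linarith)) ha
  have hW := wolfe_iff hn a c₂ ha (hc₁.trans hc₁₂) hc₂ xk hxk tk
  have hz : (xk + tk • dir hn a xk) (firstIdx hn) =
      xk (firstIdx hn) - Real.sign (xk (firstIdx hn)) * (a * tk) := by
    rw [PiLp.add_apply, PiLp.smul_apply, dir_first, smul_eq_mul]; ring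
  refine ⟨hW, ?_, ?_⟩ <;> rw [hW, hz] <;> clear hW hz <;>
    generalize xk (firstIdx hn) = u at *
  · rw [gt_iff_lt, div_lt_iff₀ ha0, mul_comm tk a]
    generalize a * tk = w
    rcases sign_cases_aux hxk with ⟨h, h'⟩ | ⟨h, h'⟩ <;> rw [h']
    · rw [abs_of_pos h]
      constructor
      · rintro ⟨h1, h2⟩
        rcases sign_cases_aux h2 with ⟨h3, h4⟩ | ⟨h3, h4⟩ <;> linarith
      · intro h1
        have h2 : u - 1 * w < 0 := by linarith
        exact ⟨Real.sign_of_neg h2, h2.ne⟩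
    · rw [abs_of_neg h]
      constructor
      · rintro ⟨h1, h2⟩
        rcases sign_cases_aux h2 with ⟨h3, h4⟩ | ⟨h3, h4⟩ <;> linarith
      · intro h1
        have h2 : 0 < u - -1 * w := by linarith
        exact ⟨by rw [Real.sign_of_pos h2]; norm_num, h2.ne'⟩
  · have hw : 0 < a * tk := mul_pos ha0 htk
    generalize a * tk = w at *
    refine and_congr_left fun hne => ?_
    rcases sign_cases_aux hne with ⟨h3, h4⟩ | ⟨h3, h4⟩ <;> rw [h4] <;>
    rcases sign_cases_aux hxk with ⟨h, h'⟩ | ⟨h, h'⟩ <;> rw [h'] at h3 ⊢ <;>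
    first | rw [abs_of_pos h] | rw [abs_of_neg h]
    all_goals first | rw [abs_of_pos h3] | rw [abs_of_neg h3]
    all_goals constructor <;> intro h5 <;> linarith
end

section
/- Suppose x_0⁽¹⁾ ≠ 0 and the gradient method is run for N steps, where each step t_k > 0 satisfies both A(t_k) and W(t_k) for k = 0,…,N−1 (so x_k⁽¹⁾ ≠ 0 for all k ≤ N). Let S_N = Σ_{k=0}^{N−1} t_k. Then c₁·(a² + n − 1)·S_N ≤ f(x_0) − f(x_N) ≤ (n−1)·S_N + a·|x_0⁽¹⁾|. -/
/-- after `N` Armijo–Wolfe steps,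
`c₁·(a² + n − 1)·S_N ≤ f(x_0) − f(x_N) ≤ (n − 1)·S_N + a·|x_0⁽¹⁾|`. -/
theorem stmt3 {n : ℕ} (hn : 2 ≤ n) (a c₁ c₂ : ℝ) (ha : Real.sqrt ((n : ℝ) - 1) ≤ a)
    (hc₁ : 0 < c₁) (hc₁₂ : c₁ < c₂) (hc₂ : c₂ < 1)
    (x : ℕ → EuclideanSpace ℝ (Fin n)) (t : ℕ → ℝ) (N : ℕ)
    (hx0 : x 0 (firstIdx hn) ≠ 0)
    (hstep : ∀ k < N, x (k + 1) = x k + t k • dir hn a (x k))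
    (ht : ∀ k < N, 0 < t k)
    (hA : ∀ k < N, armijo hn a c₁ (x k) (t k))
    (hW : ∀ k < N, wolfe hn a c₂ (x k) (t k)) :
    c₁ * (a ^ 2 + ((n : ℝ) - 1)) * (∑ k ∈ Finset.range N, t k) ≤
        objF hn a (x 0) - objF hn a (x N) ∧
      objF hn a (x 0) - objF hn a (x N) ≤
        ((n : ℝ) - 1) * (∑ k ∈ Finset.range N, t k) + a * |x 0 (firstIdx hn)| := by
  have ha0 : 0 ≤ a := (Real.sqrt_nonneg _).trans ha
  have key : ∀ M ≤ N, c₁ * (a ^ 2 + ((n : ℝ) - 1)) * (∑ k ∈ Finset.range M, t k) ≤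
        objF hn a (x 0) - objF hn a (x M) ∧
      ∑ i ∈ Finset.univ.erase (firstIdx hn), x M i =
        ∑ i ∈ Finset.univ.erase (firstIdx hn), x 0 i
          - ((n : ℝ) - 1) * (∑ k ∈ Finset.range M, t k) := by
    intro M
    induction M with
    | zero => intro _; simp
    | succ k ih =>
      intro hk
      have hkN : k < N := hk
      obtain ⟨h1, h2⟩ := ih hkN.le
      have hAk := hA k hkN
      unfold armijo at hAk
      rw [← hstep k hkN] at hAk
      refine ⟨?_, ?_⟩
      · rw [Finset.sum_range_succ]
        nlinarith
      · have h3 : ∀ i ∈ Finset.univ.erase (firstIdx hn), x (k + 1) i = x k i - t k := by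
          intro i hi
          have hi' : i ≠ firstIdx hn := Finset.ne_of_mem_erase hi
          rw [hstep k hkN]
          simp [dir, gradF, hi', sub_eq_add_neg]
        have hcard : ((Finset.univ.erase (firstIdx hn)).card : ℝ) = (n : ℝ) - 1 := by
          rw [Finset.card_erase_of_mem (Finset.mem_univ _), Finset.card_univ, Fintype.card_fin,
            Nat.cast_sub (by omega)]
          simp
        rw [Finset.sum_congr rfl h3, Finset.sum_sub_distrib, Finset.sum_const, nsmul_eq_mul,
          hcard, h2, Finset.sum_range_succ]
        ring
  obtain ⟨h1, h2⟩ := key N le_rfl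
  refine ⟨h1, ?_⟩
  have h4 : 0 ≤ a * |x N (firstIdx hn)| := mul_nonneg ha0 (abs_nonneg _)
  unfold objF
  rw [h2]
  linarith
end

section
/- Suppose x_0⁽¹⁾ ≠ 0 and the gradient method is run for all k ≥ 0 with steps t_k > 0 satisfying both A(t_k) and W(t_k). Let S_N = Σ_{k=0}^{N−1} t_k. Then the sequence (S_N)_{N≥1} is bounded above if and only if the sequence (f(x_N))_{N≥0} is bounded below. -/
/-- `(S_N)` is bounded above iff `(f(x_N))` is bounded below. -/
theorem stmt4 {n : ℕ} (hn : 2 ≤ n) (a c₁ c₂ : ℝ) (ha : Real.sqrt ((n : ℝ) - 1) ≤ a)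
    (hc₁ : 0 < c₁) (hc₁₂ : c₁ < c₂) (hc₂ : c₂ < 1)
    (x : ℕ → EuclideanSpace ℝ (Fin n)) (t : ℕ → ℝ)
    (hx0 : x 0 (firstIdx hn) ≠ 0)
    (hstep : ∀ k, x (k + 1) = x k + t k • dir hn a (x k))
    (ht : ∀ k, 0 < t k)
    (hA : ∀ k, armijo hn a c₁ (x k) (t k))
    (hW : ∀ k, wolfe hn a c₂ (x k) (t k)) :
    BddAbove (Set.range fun N => ∑ k ∈ Finset.range N, t k) ↔
      BddBelow (Set.range fun N => objF hn a (x N)) := by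
  have ha0 : 0 ≤ a := (Real.sqrt_nonneg _).trans ha
  have hn' : (2 : ℝ) ≤ n := by exact_mod_cast hn
  have hM : 0 < a ^ 2 + ((n : ℝ) - 1) := by nlinarith [sq_nonneg a]
  have hub : ∀ N, objF hn a (x N) ≤ objF hn a (x 0)
      - c₁ * (∑ k ∈ Finset.range N, t k) * (a ^ 2 + ((n : ℝ) - 1)) := by
    intro N
    induction N with
    | zero => simp
    | succ N ih =>
      have h := hA N
      unfold armijo at h
      rw [← hstep N] at h
      rw [Finset.sum_range_succ]
      linarith
  have hG : ∀ N, ∑ i ∈ Finset.univ.erase (firstIdx hn), x N i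
      = ∑ i ∈ Finset.univ.erase (firstIdx hn), x 0 i
        - ((n : ℝ) - 1) * ∑ k ∈ Finset.range N, t k := by
    intro N
    induction N with
    | zero => simp
    | succ N ih =>
      have h1 : ∀ i ∈ Finset.univ.erase (firstIdx hn), x (N + 1) i = x N i - t N := by
        intro i hi
        have hne : i ≠ firstIdx hn := Finset.ne_of_mem_erase hi
        rw [hstep N]
        simp [dir, gradF, hne]
        ring
      rw [Finset.sum_congr rfl h1, Finset.sum_sub_distrib, ih, Finset.sum_range_succ,
        Finset.sum_const, Finset.card_erase_of_mem (Finset.mem_univ _), Finset.card_univ,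
        Fintype.card_fin, nsmul_eq_mul, Nat.cast_sub (by omega)]
      push_cast
      ring
  constructor
  · rintro ⟨B, hB⟩
    refine ⟨∑ i ∈ Finset.univ.erase (firstIdx hn), x 0 i - ((n : ℝ) - 1) * B, ?_⟩
    rintro _ ⟨N, rfl⟩
    have hS : ∑ k ∈ Finset.range N, t k ≤ B := hB ⟨N, rfl⟩
    have h2 : 0 ≤ a * |x N (firstIdx hn)| := mul_nonneg ha0 (abs_nonneg _)
    have h3 : ((n : ℝ) - 1) * ∑ k ∈ Finset.range N, t k ≤ ((n : ℝ) - 1) * B :=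
      mul_le_mul_of_nonneg_left hS (by linarith)
    have h4 := hG N
    simp only [objF]
    linarith
  · rintro ⟨B, hB⟩
    refine ⟨(objF hn a (x 0) - B) / (c₁ * (a ^ 2 + ((n : ℝ) - 1))), ?_⟩
    rintro _ ⟨N, rfl⟩
    have hS : B ≤ objF hn a (x N) := hB ⟨N, rfl⟩
    have h4 := hub N
    rw [le_div_iff₀ (mul_pos hc₁ hM)]
    linarith
end

section
/- Suppose x_k⁽¹⁾ ≠ 0, t_k > 0, and the Wolfe condition W(t_k) holds. Then the Armijo condition A(t_k) holds if and only if (1 + τ)·a·t_k/2 ≤ |x_k⁽¹⁾|. -/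
/-- The objective along the search ray, in closed form. -/
lemma objF_ray {n : ℕ} (hn : 2 ≤ n) (a : ℝ) (x : EuclideanSpace ℝ (Fin n))
    (hx : x (firstIdx hn) ≠ 0) (r : ℝ) :
    objF hn a (x + r • dir hn a x) = a * |(|x (firstIdx hn)| - a * r)|
      + (∑ i ∈ Finset.univ.erase (firstIdx hn), x i) - ((n : ℝ) - 1) * r := by
  have h1 : |(x + r • dir hn a x) (firstIdx hn)| = |(|x (firstIdx hn)| - a * r)| := by
    have e : (x + r • dir hn a x) (firstIdx hn)
        = x (firstIdx hn) - r * (Real.sign (x (firstIdx hn)) * a) := by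
      simp [dir, gradF]; ring
    rw [e]
    rcases lt_or_gt_of_ne hx with h | h
    · rw [Real.sign_of_neg h, abs_of_neg h, ← abs_neg]; congr 1; ring
    · rw [Real.sign_of_pos h, abs_of_pos h]; congr 1; ring
  have h2 : ∑ i ∈ Finset.univ.erase (firstIdx hn), (x + r • dir hn a x) i
      = (∑ i ∈ Finset.univ.erase (firstIdx hn), x i) - ((n : ℝ) - 1) * r := by
    have e : ∀ i ∈ Finset.univ.erase (firstIdx hn), (x + r • dir hn a x) i = x i - r := by
      intro i hi
      have hi' : i ≠ firstIdx hn := Finset.ne_of_mem_erase hi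
      simp [dir, gradF, hi']; ring
    rw [Finset.sum_congr rfl e, Finset.sum_sub_distrib, Finset.sum_const,
      Finset.card_erase_of_mem (Finset.mem_univ _), Finset.card_univ, Fintype.card_fin,
      nsmul_eq_mul, Nat.cast_sub (by omega)]
    simp
  unfold objF
  rw [h1, h2]; ring

/-- The Wolfe condition forces the step to reach the kink. -/
lemma wolfe_cross {n : ℕ} (hn : 2 ≤ n) (a c₂ : ℝ) (hc₂ : c₂ < 1)
    (x : EuclideanSpace ℝ (Fin n)) (hx : x (firstIdx hn) ≠ 0) (t : ℝ)
    (hW : wolfe hn a c₂ x t) : |x (firstIdx hn)| ≤ a * t := by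
  by_contra! hlt
  obtain ⟨hd, hw⟩ := hW
  have hn1 : (2 : ℝ) ≤ n := by exact_mod_cast hn
  have hin : (inner ℝ (gradient (objF hn a) (x + t • dir hn a x)) (dir hn a x) : ℝ)
      = fderiv ℝ (objF hn a) (x + t • dir hn a x) (dir hn a x) := by
    simp [gradient]
  have hray : HasDerivAt (fun r : ℝ => x + r • dir hn a x) (dir hn a x) t := by
    simpa using ((hasDerivAt_id t).smul_const (dir hn a x)).const_add x
  have hg := hd.hasFDerivAt.comp_hasDerivAt t hray
  have hev : (objF hn a ∘ fun r : ℝ => x + r • dir hn a x) =ᶠ[nhds t]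
      fun r => a * |x (firstIdx hn)| + (∑ i ∈ Finset.univ.erase (firstIdx hn), x i)
        - (a ^ 2 + ((n : ℝ) - 1)) * r := by
    have hc : ContinuousAt (fun r : ℝ => a * r) t := by fun_prop
    filter_upwards [hc.eventually (gt_mem_nhds hlt)] with r hr
    simp only [Function.comp]
    rw [objF_ray hn a x hx, abs_of_pos (a := |x (firstIdx hn)| - a * r) (by linarith)]
    ring
  have hl : HasDerivAt (fun r : ℝ => a * |x (firstIdx hn)|
      + (∑ i ∈ Finset.univ.erase (firstIdx hn), x i)
        - (a ^ 2 + ((n : ℝ) - 1)) * r) (-(a ^ 2 + ((n : ℝ) - 1))) t := by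
    have h0 := ((hasDerivAt_id t).const_mul (a ^ 2 + ((n : ℝ) - 1))).const_sub
      (a * |x (firstIdx hn)| + (∑ i ∈ Finset.univ.erase (firstIdx hn), x i))
    rw [mul_one] at h0
    exact h0
  have := hg.unique (hl.congr_of_eventuallyEq hev)
  rw [hin, this] at hw
  nlinarith [sq_nonneg a]

/-- if `W(t_k)` holds, then `A(t_k)` holds iff
`(1 + τ)·a·t_k/2 ≤ |x_k⁽¹⁾|`. -/
theorem stmt7 {n : ℕ} (hn : 2 ≤ n) (a c₁ c₂ : ℝ) (ha : Real.sqrt ((n : ℝ) - 1) ≤ a)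
    (hc₁ : 0 < c₁) (hc₁₂ : c₁ < c₂) (hc₂ : c₂ < 1)
    (xk : EuclideanSpace ℝ (Fin n)) (hxk : xk (firstIdx hn) ≠ 0)
    (tk : ℝ) (htk : 0 < tk) (hW : wolfe hn a c₂ xk tk) :
    armijo hn a c₁ xk tk ↔ (1 + tauP n a c₁) * a * tk / 2 ≤ |xk (firstIdx hn)| := by
  have hcross := wolfe_cross hn a c₂ hc₂ xk hxk tk hW
  have hn1 : (2 : ℝ) ≤ n := by exact_mod_cast hn
  have hapos : 0 < a := lt_of_lt_of_le (Real.sqrt_pos.mpr (by linarith)) ha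
  unfold armijo
  rw [objF_ray hn a xk hxk, abs_of_nonpos (a := |xk (firstIdx hn)| - a * tk) (by linarith)]
  unfold objF
  have key : 2 * a * ((1 + tauP n a c₁) * a * tk / 2)
      = a ^ 2 * tk - ((n : ℝ) - 1) * tk + c₁ * tk * (a ^ 2 + ((n : ℝ) - 1)) := by
    unfold tauP
    field_simp
    ring
  rw [← mul_le_mul_iff_right₀ (b := (1 + tauP n a c₁) * a * tk / 2)
    (show 0 < 2 * a by linarith), key]
  constructor <;> intro h <;> nlinarith
end

section
/- Suppose x_k⁽¹⁾ ≠ 0 and set t_k = 2|x_k⁽¹⁾| / ((τ + 1)·a). Then both the Armijo condition A(t_k) and the Wolfe condition W(t_k) hold. -/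
theorem gradF_first {n : ℕ} (hn : 2 ≤ n) (a : ℝ) (x : EuclideanSpace ℝ (Fin n)) :
    gradF hn a x (firstIdx hn) = Real.sign (x (firstIdx hn)) * a := by
  simp [gradF]

theorem gradF_other {n : ℕ} (hn : 2 ≤ n) (a : ℝ) (x : EuclideanSpace ℝ (Fin n)) (i : Fin n)
    (hi : i ≠ firstIdx hn) : gradF hn a x i = 1 := by
  simp [gradF, hi]

theorem inner_gradF {n : ℕ} (hn : 2 ≤ n) (a : ℝ) (x y : EuclideanSpace ℝ (Fin n)) :
    inner ℝ (gradF hn a x) y = Real.sign (x (firstIdx hn)) * a * y (firstIdx hn)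
      + ∑ i ∈ Finset.univ.erase (firstIdx hn), y i := by
  rw [PiLp.inner_apply, ← Finset.add_sum_erase _ _ (Finset.mem_univ (firstIdx hn))]
  congr 1
  · rw [gradF_first]; simp [mul_comm]
  · refine Finset.sum_congr rfl fun i hi => ?_
    rw [gradF_other hn a x i (Finset.ne_of_mem_erase hi)]; simp

theorem sum_dir {n : ℕ} (hn : 2 ≤ n) (a : ℝ) (x : EuclideanSpace ℝ (Fin n)) :
    ∑ i ∈ Finset.univ.erase (firstIdx hn), dir hn a x i = -((n : ℝ) - 1) := by
  have h : ∀ i ∈ Finset.univ.erase (firstIdx hn), dir hn a x i = -1 := fun i hi => by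
    simp [dir, gradF_other hn a x i (Finset.ne_of_mem_erase hi)]
  rw [Finset.sum_congr rfl h, Finset.sum_const, Finset.card_erase_of_mem (Finset.mem_univ _)]
  have : 1 ≤ n := by omega
  simp [Nat.cast_sub this]

theorem hasGradientAt_objF {n : ℕ} (hn : 2 ≤ n) (a : ℝ) (y : EuclideanSpace ℝ (Fin n))
    (hy : y (firstIdx hn) ≠ 0) : HasGradientAt (objF hn a) (gradF hn a y) y := by
  rw [hasGradientAt_iff_hasFDerivAt]
  refine (InnerProductSpace.toDual ℝ _ (gradF hn a y)).hasFDerivAt.congr_of_eventuallyEq ?_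
  have hc : Continuous fun z : EuclideanSpace ℝ (Fin n) => z (firstIdx hn) := by fun_prop
  rcases lt_or_gt_of_ne hy with h | h
  · filter_upwards [hc.continuousAt.eventually_lt continuousAt_const h] with z hz
    rw [InnerProductSpace.toDual_apply_apply, inner_gradF, objF, Real.sign_of_neg h, abs_of_neg hz]
    ring
  · filter_upwards [continuousAt_const.eventually_lt hc.continuousAt h] with z hz
    rw [InnerProductSpace.toDual_apply_apply, inner_gradF, objF, Real.sign_of_pos h, abs_of_pos hz]
    ring

/-- the step `t_k = 2|x_k⁽¹⁾| / ((τ + 1)·a)` satisfies both `A(t_k)`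
and `W(t_k)`. -/
theorem stmt8 {n : ℕ} (hn : 2 ≤ n) (a c₁ c₂ : ℝ) (ha : Real.sqrt ((n : ℝ) - 1) ≤ a)
    (hc₁ : 0 < c₁) (hc₁₂ : c₁ < c₂) (hc₂ : c₂ < 1)
    (xk : EuclideanSpace ℝ (Fin n)) (hxk : xk (firstIdx hn) ≠ 0)
    (tk : ℝ) (htk : tk = 2 * |xk (firstIdx hn)| / ((tauP n a c₁ + 1) * a)) :
    armijo hn a c₁ xk tk ∧ wolfe hn a c₂ xk tk := by
  have hm : (1 : ℝ) ≤ (n : ℝ) - 1 := by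
    have : (2 : ℝ) ≤ n := by exact_mod_cast hn
    linarith
  have ha0 : 0 < a := lt_of_lt_of_le (Real.sqrt_pos.2 (by linarith)) ha
  have ha2 : (n : ℝ) - 1 ≤ a ^ 2 := (Real.sqrt_le_left ha0.le).1 ha
  have hu : 0 < |xk (firstIdx hn)| := abs_pos.2 hxk
  have hT : (tauP n a c₁ + 1) * a ^ 2 = a ^ 2 - ((n : ℝ) - 1) + c₁ * (a ^ 2 + ((n : ℝ) - 1)) := by
    unfold tauP; field_simp; ring
  have hc : 0 < c₁ * (a ^ 2 + ((n : ℝ) - 1)) := by positivity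
  have hc' : c₁ * (a ^ 2 + ((n : ℝ) - 1)) < 1 * (a ^ 2 + ((n : ℝ) - 1)) :=
    mul_lt_mul_of_pos_right (by linarith) (by positivity)
  have hT0 : 0 < tauP n a c₁ + 1 :=
    pos_of_mul_pos_left (by rw [hT]; linarith) (sq_nonneg a)
  have hT2 : tauP n a c₁ + 1 < 2 :=
    lt_of_mul_lt_mul_right (by rw [hT]; linarith) (sq_nonneg a)
  have hS : tk * ((tauP n a c₁ + 1) * a) = 2 * |xk (firstIdx hn)| := by
    rw [htk]; field_simp
  have htk0 : 0 < tk := by rw [htk]; positivity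
  have hat : |xk (firstIdx hn)| < a * tk := by
    have := mul_lt_mul_of_pos_right hT2 (mul_pos ha0 htk0)
    linarith
  have hA : tk * (a ^ 2 - ((n : ℝ) - 1) + c₁ * (a ^ 2 + ((n : ℝ) - 1)))
      = 2 * a * |xk (firstIdx hn)| := by
    rw [← hT]; linear_combination a * hS
  have hd : dir hn a xk (firstIdx hn) = -(Real.sign (xk (firstIdx hn)) * a) := by
    simp [dir, gradF_first]
  have hy : (xk + tk • dir hn a xk) (firstIdx hn)
      = xk (firstIdx hn) - Real.sign (xk (firstIdx hn)) * (a * tk) := by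
    simp [hd]; ring
  have hsum : ∑ i ∈ Finset.univ.erase (firstIdx hn), (xk + tk • dir hn a xk) i
      = ∑ i ∈ Finset.univ.erase (firstIdx hn), xk i - tk * ((n : ℝ) - 1) := by
    simp only [PiLp.add_apply, PiLp.smul_apply, smul_eq_mul, Finset.sum_add_distrib,
      ← Finset.mul_sum, sum_dir]
    ring
  have key : |(xk + tk • dir hn a xk) (firstIdx hn)| = a * tk - |xk (firstIdx hn)| ∧
      (xk + tk • dir hn a xk) (firstIdx hn) ≠ 0 ∧
      Real.sign ((xk + tk • dir hn a xk) (firstIdx hn)) * Real.sign (xk (firstIdx hn)) = -1 := by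
    rw [hy]
    rcases lt_or_gt_of_ne hxk with h | h
    · rw [abs_of_neg h] at hat
      have h2 : 0 < xk (firstIdx hn) - -1 * (a * tk) := by linarith
      rw [Real.sign_of_neg h, abs_of_pos h2, abs_of_neg h, Real.sign_of_pos h2]
      exact ⟨by ring, h2.ne', by norm_num⟩
    · rw [abs_of_pos h] at hat
      have h2 : xk (firstIdx hn) - 1 * (a * tk) < 0 := by linarith
      rw [Real.sign_of_pos h, abs_of_neg h2, abs_of_pos h, Real.sign_of_neg h2]
      exact ⟨by ring, h2.ne, by norm_num⟩
  obtain ⟨k1, k2, k3⟩ := key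
  have hg := hasGradientAt_objF hn a _ k2
  refine ⟨?_, hg.differentiableAt, ?_⟩
  · unfold armijo objF
    rw [k1, hsum]
    linarith
  · rw [hg.gradient, inner_gradF, sum_dir, hd]
    have e : Real.sign ((xk + tk • dir hn a xk) (firstIdx hn)) * a *
        -(Real.sign (xk (firstIdx hn)) * a) = a ^ 2 := by
      linear_combination (-a ^ 2) * k3
    rw [e]
    have : 0 < c₂ * (a ^ 2 + ((n : ℝ) - 1)) := mul_pos (by linarith) (by positivity)
    linarith
end

section
/- Suppose x_k⁽¹⁾ ≠ 0, t_k = 2|x_k⁽¹⁾| / ((τ + 1)·a), and x_{k+1} = x_k + t_k·d_k. Then |x_{k+1}⁽¹⁾| = C·|x_k⁽¹⁾| where C = (1 − τ)/(1 + τ); in particular x_{k+1}⁽¹⁾ ≠ 0. -/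
/-- with `t_k = 2|x_k⁽¹⁾| / ((τ + 1)·a)` and `x_{k+1} = x_k + t_k·d_k`,
one has `|x_{k+1}⁽¹⁾| = C·|x_k⁽¹⁾|` with `C = (1 − τ)/(1 + τ)`; in particular
`x_{k+1}⁽¹⁾ ≠ 0`. -/
theorem stmt9 {n : ℕ} (hn : 2 ≤ n) (a c₁ c₂ : ℝ) (ha : Real.sqrt ((n : ℝ) - 1) ≤ a)
    (hc₁ : 0 < c₁) (hc₁₂ : c₁ < c₂) (hc₂ : c₂ < 1)
    (xk : EuclideanSpace ℝ (Fin n)) (hxk : xk (firstIdx hn) ≠ 0)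
    (tk : ℝ) (htk : tk = 2 * |xk (firstIdx hn)| / ((tauP n a c₁ + 1) * a)) :
    |(xk + tk • dir hn a xk) (firstIdx hn)| =
        ((1 - tauP n a c₁) / (1 + tauP n a c₁)) * |xk (firstIdx hn)| ∧
      (xk + tk • dir hn a xk) (firstIdx hn) ≠ 0 := by
  have hn' : (1 : ℝ) ≤ (n : ℝ) - 1 := by
    have : (2 : ℝ) ≤ n := by exact_mod_cast hn
    linarith
  have hs : (1 : ℝ) ≤ Real.sqrt ((n : ℝ) - 1) := Real.one_le_sqrt.mpr hn'
  have hapos : 0 < a := by linarith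
  have hsq : (n : ℝ) - 1 ≤ a ^ 2 := (Real.sqrt_le_left hapos.le).mp ha
  have ha2 : 0 < a ^ 2 := by positivity
  set r : ℝ := ((n : ℝ) - 1) / a ^ 2 with hr
  have hr0 : 0 < r := div_pos (by linarith) ha2
  have hr1 : r ≤ 1 := (div_le_one ha2).mpr hsq
  have htau : tauP n a c₁ = c₁ - r * (1 - c₁) := by
    unfold tauP
    rw [hr]
    ring
  have hlt : tauP n a c₁ < 1 := by rw [htau]; nlinarith
  have hgt : -1 < tauP n a c₁ := by rw [htau]; nlinarith
  generalize tauP n a c₁ = τ at *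
  have hcoord : (xk + tk • dir hn a xk) (firstIdx hn)
      = xk (firstIdx hn) - tk * (Real.sign (xk (firstIdx hn)) * a) := by
    simp [dir, gradF]
    ring
  have hp : 0 < 1 + τ := by linarith
  have hp' : τ + 1 ≠ 0 := by linarith
  have hC : 0 < (1 - τ) / (1 + τ) := div_pos (by linarith) hp
  have key : |(xk + tk • dir hn a xk) (firstIdx hn)| =
        ((1 - τ) / (1 + τ)) * |xk (firstIdx hn)| := by
    rw [hcoord, htk]
    generalize xk (firstIdx hn) = u at *
    rcases lt_or_gt_of_ne hxk with h | h
    · rw [Real.sign_of_neg h, abs_of_neg h]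
      have : u - 2 * -u / ((τ + 1) * a) * (-1 * a) = (1 - τ) / (1 + τ) * (-u) := by
        field_simp
        ring
      rw [this, abs_of_pos (mul_pos hC (by linarith))]
    · rw [Real.sign_of_pos h, abs_of_pos h]
      have : u - 2 * u / ((τ + 1) * a) * (1 * a) = -((1 - τ) / (1 + τ) * u) := by
        field_simp
        ring
      rw [this, abs_neg, abs_of_pos (mul_pos hC h)]
  refine ⟨key, ?_⟩
  rw [← abs_pos, key]
  exact mul_pos hC (abs_pos.mpr hxk)
end

section
/- Suppose x_0⁽¹⁾ ≠ 0 and the gradient method is run for all k ≥ 0 with steps t_k = 2|x_k⁽¹⁾| / ((τ + 1)·a) (these steps keep x_k⁽¹⁾ ≠ 0 for all k). If τ ≤ 0, then f(x_k) → −∞ as k → ∞; in particular f(x_k) is unbounded below. -/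
/-- with steps `t_k = 2|x_k⁽¹⁾| / ((τ + 1)·a)` and `τ ≤ 0`,
`f(x_k) → −∞`; in particular `(f(x_k))` is unbounded below. -/
theorem stmt10 {n : ℕ} (hn : 2 ≤ n) (a c₁ c₂ : ℝ) (ha : Real.sqrt ((n : ℝ) - 1) ≤ a)
    (hc₁ : 0 < c₁) (hc₁₂ : c₁ < c₂) (hc₂ : c₂ < 1)
    (hτ : tauP n a c₁ ≤ 0)
    (x : ℕ → EuclideanSpace ℝ (Fin n)) (t : ℕ → ℝ)
    (hx0 : x 0 (firstIdx hn) ≠ 0)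
    (ht : ∀ k, t k = 2 * |x k (firstIdx hn)| / ((tauP n a c₁ + 1) * a))
    (hstep : ∀ k, x (k + 1) = x k + t k • dir hn a (x k)) :
    Filter.Tendsto (fun k => objF hn a (x k)) Filter.atTop Filter.atBot ∧
      ¬ BddBelow (Set.range fun k => objF hn a (x k)) := by
  have hn' : (1:ℝ) ≤ (n:ℝ) - 1 := by
    have : (2:ℝ) ≤ n := by exact_mod_cast hn
    linarith
  have ha0 : 0 < a := lt_of_lt_of_le (Real.sqrt_pos.mpr (by linarith)) ha
  have ha2 : (n:ℝ) - 1 ≤ a ^ 2 := by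
    rw [Real.sqrt_le_left ha0.le] at ha
    exact ha
  have hmul : tauP n a c₁ * a ^ 2 = c₁ * a ^ 2 + ((n:ℝ) - 1) * (c₁ - 1) := by
    unfold tauP
    field_simp
  generalize tauP n a c₁ = τ at *
  have hτ1 : 0 < τ + 1 := by
    have h1 : 0 < (τ + 1) * a ^ 2 := by nlinarith
    exact pos_of_mul_pos_left h1 (by positivity)
  have hfirst : ∀ k, x (k + 1) (firstIdx hn)
      = x k (firstIdx hn) - Real.sign (x k (firstIdx hn)) * a * t k := by
    intro k
    rw [hstep k]
    simp [dir, gradF]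
    ring
  have habs : ∀ k, |x (k + 1) (firstIdx hn)| = |x k (firstIdx hn)| * ((1 - τ) / (τ + 1)) := by
    intro k
    have e : x (k + 1) (firstIdx hn) = x k (firstIdx hn) * (-((1 - τ) / (τ + 1))) := by
      rw [hfirst, ht k]
      have hs : Real.sign (x k (firstIdx hn)) * |x k (firstIdx hn)| = x k (firstIdx hn) := by
        rcases lt_trichotomy (x k (firstIdx hn)) 0 with h | h | h
        · rw [Real.sign_of_neg h, abs_of_neg h]; ring
        · rw [h]; simp
        · rw [Real.sign_of_pos h, abs_of_pos h]; ring
      have : Real.sign (x k (firstIdx hn)) * a * (2 * |x k (firstIdx hn)| / ((τ + 1) * a))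
          = (Real.sign (x k (firstIdx hn)) * |x k (firstIdx hn)|) * (2 / (τ + 1)) := by
        field_simp
      rw [this, hs]
      field_simp
      ring
    rw [e, abs_mul, abs_neg, abs_of_nonneg (a := (1 - τ) / (τ + 1))]
    exact div_nonneg (by linarith) hτ1.le
  have hu : ∀ k, |x 0 (firstIdx hn)| ≤ |x k (firstIdx hn)| := by
    intro k
    induction k with
    | zero => exact le_rfl
    | succ k ih =>
      rw [habs]
      refine ih.trans (le_mul_of_one_le_right (abs_nonneg _) ?_)
      rw [le_div_iff₀ hτ1]
      linarith
  have hsum : ∀ k, ∑ i ∈ Finset.univ.erase (firstIdx hn), x (k + 1) i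
      = ∑ i ∈ Finset.univ.erase (firstIdx hn), x k i - ((n:ℝ) - 1) * t k := by
    intro k
    have h1 : ∀ i ∈ Finset.univ.erase (firstIdx hn), x (k + 1) i = x k i - t k := by
      intro i hi
      have hi' := Finset.ne_of_mem_erase hi
      rw [hstep k]
      simp [dir, gradF, hi']
      ring
    rw [Finset.sum_congr rfl h1, Finset.sum_sub_distrib, Finset.sum_const,
      Finset.card_erase_of_mem (Finset.mem_univ _), Finset.card_univ, Fintype.card_fin,
      nsmul_eq_mul, Nat.cast_sub (by omega), Nat.cast_one]
  have hdec : ∀ k, objF hn a (x (k + 1))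
      = objF hn a (x k) - c₁ * (a ^ 2 + ((n:ℝ) - 1)) * t k := by
    intro k
    have hc : c₁ * (a ^ 2 + ((n:ℝ) - 1)) = τ * a ^ 2 + ((n:ℝ) - 1) := by
      rw [hmul]; ring
    rw [hc]
    unfold objF
    rw [hsum, habs, ht k]
    field_simp
    ring
  obtain ⟨C, hC, hCt⟩ : ∃ C : ℝ, 0 < C ∧ ∀ k, C ≤ c₁ * (a ^ 2 + ((n:ℝ) - 1)) * t k := by
    have hp : 0 < c₁ * (a ^ 2 + ((n:ℝ) - 1)) := by
      apply mul_pos hc₁; nlinarith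
    have hx0' := abs_pos.mpr hx0
    refine ⟨c₁ * (a ^ 2 + ((n:ℝ) - 1)) * t 0, ?_, ?_⟩
    · rw [ht]; positivity
    · intro k
      have := hu k
      rw [ht, ht]
      gcongr
  have hbound : ∀ k : ℕ, objF hn a (x k) ≤ objF hn a (x 0) + -((k:ℝ) * C) := by
    intro k
    induction k with
    | zero => simp
    | succ k ih =>
      rw [hdec]
      have := hCt k
      push_cast
      linarith
  have htend : Filter.Tendsto (fun k => objF hn a (x k)) Filter.atTop Filter.atBot := by
    refine Filter.tendsto_atBot_mono hbound ?_
    apply Filter.tendsto_atBot_add_const_left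
    apply Filter.tendsto_neg_atTop_atBot.comp
    exact tendsto_natCast_atTop_atTop.atTop_mul_const hC
  exact ⟨htend, Filter.not_bddBelow_of_tendsto_atBot htend⟩
end

section
/- Suppose τ ≤ 0, x_0⁽¹⁾ ≠ 0 and |x_0⁽¹⁾| > a, and set r_0 = ⌈log₂(|x_0⁽¹⁾|/a)⌉. Suppose the gradient method is run so that for every k: |x_k⁽¹⁾| is not equal to a·2^{j} for any integer j; if |x_k⁽¹⁾| > a then t_k = 2^{r_k} where r_k = ⌈log₂(|x_k⁽¹⁾|/a)⌉; and if |x_k⁽¹⁾| < a then 0 < t_k ≤ 1 and W(t_k) holds. Then there exists j ≤ r_0 such that |x_j⁽¹⁾| < a, and moreover |x_k⁽¹⁾| < a for all k ≥ j. -/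
theorem aux_abs_step {n : ℕ} (hn : 2 ≤ n) (a : ℝ) (x : EuclideanSpace ℝ (Fin n)) (t : ℝ)
    (hx : x (firstIdx hn) ≠ 0) :
    |(x + t • dir hn a x) (firstIdx hn)| = |(|x (firstIdx hn)|) - a * t| := by
  have h : (x + t • dir hn a x) (firstIdx hn)
      = x (firstIdx hn) - t * (Real.sign (x (firstIdx hn)) * a) := by
    simp [dir, gradF]
    ring
  rw [h]
  rcases lt_or_gt_of_ne hx with h0 | h0
  · rw [Real.sign_of_neg h0, abs_of_neg h0, ← abs_neg]
    congr 1
    ring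
  · rw [Real.sign_of_pos h0, abs_of_pos h0]
    congr 1
    ring

theorem aux_abs_step_zero {n : ℕ} (hn : 2 ≤ n) (a : ℝ) (x : EuclideanSpace ℝ (Fin n)) (t : ℝ)
    (hx : x (firstIdx hn) = 0) :
    |(x + t • dir hn a x) (firstIdx hn)| = 0 := by
  simp [dir, gradF, hx]

/-- if `τ ≤ 0` and `|x_0⁽¹⁾| > a`, and the method takes the step
`t_k = 2^(r_k)` with `r_k = ⌈log₂(|x_k⁽¹⁾|/a)⌉` whenever `|x_k⁽¹⁾| > a`, and some step
`0 < t_k ≤ 1` satisfying `W(t_k)` whenever `|x_k⁽¹⁾| < a` (where `|x_k⁽¹⁾|` is never of the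
form `a·2^j`), then `|x_j⁽¹⁾| < a` for some `j ≤ r_0`, and `|x_k⁽¹⁾| < a` for all `k ≥ j`. -/
theorem stmt13 {n : ℕ} (hn : 2 ≤ n) (a c₁ c₂ : ℝ) (ha : Real.sqrt ((n : ℝ) - 1) ≤ a)
    (hc₁ : 0 < c₁) (hc₁₂ : c₁ < c₂) (hc₂ : c₂ < 1)
    (hτ : tauP n a c₁ ≤ 0)
    (x : ℕ → EuclideanSpace ℝ (Fin n)) (t : ℕ → ℝ)
    (hx0 : x 0 (firstIdx hn) ≠ 0) (hx0a : a < |x 0 (firstIdx hn)|)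
    (hstep : ∀ k, x (k + 1) = x k + t k • dir hn a (x k))
    (hdyadic : ∀ k, ∀ j : ℤ, |x k (firstIdx hn)| ≠ a * 2 ^ j)
    (htbig : ∀ k, a < |x k (firstIdx hn)| →
        t k = 2 ^ ⌈Real.logb 2 (|x k (firstIdx hn)| / a)⌉)
    (htsmall : ∀ k, |x k (firstIdx hn)| < a →
        0 < t k ∧ t k ≤ 1 ∧ wolfe hn a c₂ (x k) (t k)) :
    ∃ j : ℕ, (j : ℤ) ≤ ⌈Real.logb 2 (|x 0 (firstIdx hn)| / a)⌉ ∧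
      |x j (firstIdx hn)| < a ∧ ∀ k, j ≤ k → |x k (firstIdx hn)| < a := by
  have hn' : (2 : ℝ) ≤ n := by exact_mod_cast hn
  have ha0 : 0 < a := lt_of_lt_of_le (Real.sqrt_pos.2 (by linarith)) ha
  have hsmall : ∀ k, |x k (firstIdx hn)| < a → |x (k + 1) (firstIdx hn)| < a := by
    intro k hk
    obtain ⟨h0, h1, -⟩ := htsmall k hk
    rw [hstep k]
    by_cases hz : x k (firstIdx hn) = 0
    · rw [aux_abs_step_zero hn a _ _ hz]
      exact ha0
    · rw [aux_abs_step hn a _ _ hz, abs_lt]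
      have hp := abs_pos.2 hz
      constructor <;> nlinarith [mul_pos ha0 h0, mul_le_mul_of_nonneg_left h1 ha0.le]
  have hstay : ∀ j k, j ≤ k → |x j (firstIdx hn)| < a → |x k (firstIdx hn)| < a := by
    intro j k hjk hj
    induction k, hjk using Nat.le_induction with
    | base => exact hj
    | succ k _ ih => exact hsmall k ih
  have hmain : ∀ m k : ℕ, |x k (firstIdx hn)| ≤ a * 2 ^ m →
      ∃ j ≤ m, |x (k + j) (firstIdx hn)| < a := by
    intro m
    induction m with
    | zero =>
      intro k hk
      refine ⟨0, le_rfl, lt_of_le_of_ne (by simpa using hk) ?_⟩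
      simpa using hdyadic k 0
    | succ m ih =>
      intro k hk
      by_cases hka : |x k (firstIdx hn)| ≤ a
      · refine ⟨0, Nat.zero_le _, lt_of_le_of_ne (by simpa using hka) ?_⟩
        simpa using hdyadic k 0
      push Not at hka
      have hpos : 0 < |x k (firstIdx hn)| := ha0.trans hka
      have hq : 0 < |x k (firstIdx hn)| / a := div_pos hpos ha0
      have ht := htbig k hka
      set y := |x k (firstIdx hn)| with hy
      set r := ⌈Real.logb 2 (y / a)⌉ with hr
      have hrle : r ≤ (m : ℤ) + 1 := by
        rw [hr, Int.ceil_le, Real.logb_le_iff_le_rpow (by norm_num) hq]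
        rw [Real.rpow_intCast, div_le_iff₀ ha0]
        have : (2 : ℝ) ^ ((m : ℤ) + 1) = 2 ^ (m + 1) := by exact_mod_cast zpow_natCast (2 : ℝ) (m + 1)
        rw [this]
        linarith
      have hup : y ≤ a * 2 ^ r := by
        have h := Int.le_ceil (Real.logb 2 (y / a))
        rw [Real.logb_le_iff_le_rpow (by norm_num) hq, Real.rpow_intCast, div_le_iff₀ ha0] at h
        linarith
      have hlow : a * 2 ^ (r - 1) < y := by
        have h : ((r - 1 : ℤ) : ℝ) < Real.logb 2 (y / a) := by
          push_cast
          linarith [Int.ceil_lt_add_one (Real.logb 2 (y / a))]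
        rw [Real.lt_logb_iff_rpow_lt (by norm_num) hq, Real.rpow_intCast, lt_div_iff₀ ha0] at h
        linarith
      have h2 : (2 : ℝ) ^ r = 2 * 2 ^ (r - 1) := by
        rw [zpow_sub_one₀ (by norm_num)]
        ring
      have h3 : (2 : ℝ) ^ (r - 1) ≤ 2 ^ m := by
        rw [← zpow_natCast (2 : ℝ) m]
        exact zpow_le_zpow_right₀ (by norm_num) (by omega)
      have hnext : |x (k + 1) (firstIdx hn)| ≤ a * 2 ^ m := by
        rw [hstep k, aux_abs_step hn a _ _ (abs_pos.1 hpos), ← hy, ht,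
          abs_of_nonpos (by linarith)]
        have := mul_le_mul_of_nonneg_left h3 ha0.le
        rw [h2]
        linarith
      obtain ⟨j, hj, hlt⟩ := ih (k + 1) hnext
      refine ⟨j + 1, by omega, ?_⟩
      rwa [show k + (j + 1) = k + 1 + j by ring]
  have hq : 0 < |x 0 (firstIdx hn)| / a := div_pos (ha0.trans hx0a) ha0
  have hr0 : 0 ≤ ⌈Real.logb 2 (|x 0 (firstIdx hn)| / a)⌉ :=
    Int.ceil_nonneg (Real.logb_nonneg (by norm_num) ((one_le_div ha0).2 hx0a.le))
  obtain ⟨m, hm⟩ := Int.eq_ofNat_of_zero_le hr0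
  have hup : |x 0 (firstIdx hn)| ≤ a * 2 ^ m := by
    have h := Int.le_ceil (Real.logb 2 (|x 0 (firstIdx hn)| / a))
    rw [hm, Real.logb_le_iff_le_rpow (by norm_num) hq, Real.rpow_intCast, div_le_iff₀ ha0,
      zpow_natCast] at h
    linarith
  obtain ⟨j, hj, hlt⟩ := hmain m 0 hup
  rw [Nat.zero_add] at hlt
  exact ⟨j, by rw [hm]; exact_mod_cast hj, hlt, fun k hk => hstay j k hk hlt⟩
end

section
/- Suppose τ = 0, x_k⁽¹⁾ ≠ 0, and let p ≥ 1 be an integer such that a/2^{p} < |x_k⁽¹⁾| < a/2^{p−1}. If t_k = 2^{1−p} and x_{k+1} = x_k + t_k·d_k, then 0 < |x_{k+1}⁽¹⁾| < a/2^{p}; consequently, for any integer p' with a/2^{p'} < |x_{k+1}⁽¹⁾| < a/2^{p'−1} one has p' ≥ p + 1, and the corresponding next step t_{k+1} = 2^{1−p'} satisfies t_{k+1} ≤ t_k/2. -/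
/-- suppose `τ = 0`, `a/2^p < |x_k⁽¹⁾| < a/2^(p−1)` with `p ≥ 1`, and
`t_k = 2^(1−p)`. Then `0 < |x_{k+1}⁽¹⁾| < a/2^p`; consequently any `p'` with
`a/2^p' < |x_{k+1}⁽¹⁾| < a/2^(p'−1)` satisfies `p' ≥ p + 1`, and the corresponding next
step `t_{k+1} = 2^(1−p')` satisfies `t_{k+1} ≤ t_k/2`. -/
theorem stmt15 {n : ℕ} (hn : 2 ≤ n) (a c₁ c₂ : ℝ) (ha : Real.sqrt ((n : ℝ) - 1) ≤ a)
    (hc₁ : 0 < c₁) (hc₁₂ : c₁ < c₂) (hc₂ : c₂ < 1)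
    (hτ : tauP n a c₁ = 0)
    (xk : EuclideanSpace ℝ (Fin n)) (hxk : xk (firstIdx hn) ≠ 0)
    (p : ℕ) (hp : 1 ≤ p)
    (hlb : a / 2 ^ p < |xk (firstIdx hn)|) (hub : |xk (firstIdx hn)| < a / 2 ^ (p - 1))
    (tk : ℝ) (htk : tk = 2 ^ (1 - (p : ℤ))) :
    0 < |(xk + tk • dir hn a xk) (firstIdx hn)| ∧
      |(xk + tk • dir hn a xk) (firstIdx hn)| < a / 2 ^ p ∧
      ∀ p' : ℕ, a / 2 ^ p' < |(xk + tk • dir hn a xk) (firstIdx hn)| →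
        |(xk + tk • dir hn a xk) (firstIdx hn)| < a / 2 ^ (p' - 1) →
        p + 1 ≤ p' ∧ (2 : ℝ) ^ (1 - (p' : ℤ)) ≤ tk / 2 := by
  have hq : a / 2 ^ (p - 1) = 2 * (a / 2 ^ p) := by
    obtain ⟨m, rfl⟩ : ∃ m, p = m + 1 := ⟨p - 1, by omega⟩
    simp only [Nat.add_sub_cancel, pow_succ]
    field_simp
  have ht : tk = 2 / 2 ^ p := by
    rw [htk, zpow_sub₀ (by norm_num)]
    simp
  rw [hq] at hub
  have hpow : (0 : ℝ) < 2 ^ p := by positivity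
  have hqpos : 0 < a / 2 ^ p := by
    linarith
  have hapos : 0 < a := by
    have h := mul_pos hqpos hpow
    rwa [div_mul_cancel₀ _ hpow.ne'] at h
  have hcoord : (xk + tk • dir hn a xk) (firstIdx hn)
      = xk (firstIdx hn) - Real.sign (xk (firstIdx hn)) * (2 * (a / 2 ^ p)) := by
    simp [dir, gradF, ht]
    ring
  have habs : |(xk + tk • dir hn a xk) (firstIdx hn)|
      = 2 * (a / 2 ^ p) - |xk (firstIdx hn)| := by
    rw [hcoord]
    rcases lt_or_gt_of_ne hxk with h | h
    · rw [Real.sign_of_neg h]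
      rw [abs_of_neg h] at hub ⊢
      rw [abs_of_pos (by linarith)]
      ring
    · rw [Real.sign_of_pos h]
      rw [abs_of_pos h] at hub ⊢
      rw [abs_of_neg (by linarith)]
      ring
  rw [habs]
  refine ⟨by linarith, by linarith, ?_⟩
  intro p' h1 _
  have h2 : a / 2 ^ p' < a / 2 ^ p := by linarith
  have h3 : (2 : ℝ) ^ p < 2 ^ p' := by
    by_contra hcon
    have h4 : a / 2 ^ p ≤ a / 2 ^ p' :=
      div_le_div_of_nonneg_left hapos.le (by positivity) (not_lt.mp hcon)
    linarith
  have h5 : p < p' := (pow_lt_pow_iff_right₀ (by norm_num)).mp h3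
  refine ⟨h5, ?_⟩
  have h6 : tk / 2 = (2 : ℝ) ^ (-(p : ℤ)) := by
    rw [ht, zpow_neg, zpow_natCast]
    field_simp
  rw [h6]
  exact zpow_le_zpow_right₀ (by norm_num) (by omega)
end

section
/- Suppose τ = 0 and 0 < |x_0⁽¹⁾| < a, and suppose the gradient method is run so that for every k: x_k⁽¹⁾ ≠ 0, the strict bracketing a/2^{p_k} < |x_k⁽¹⁾| < a/2^{p_k−1} holds where p_k = ⌈log₂(a/|x_k⁽¹⁾|)⌉, and t_k = 2^{1−p_k}. Then the sequence (x_k) converges to a point x̄ ∈ ℝⁿ with x̄⁽¹⁾ = 0, and (f(x_k)) is bounded below. -/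
/-- suppose `τ = 0`, `0 < |x_0⁽¹⁾| < a`, and at every iteration
`a/2^(p_k) < |x_k⁽¹⁾| < a/2^(p_k−1)` with `p_k = ⌈log₂(a/|x_k⁽¹⁾|)⌉` and `t_k = 2^(1−p_k)`.
Then `(x_k)` converges to a point `x̄` with `x̄⁽¹⁾ = 0`, and `(f(x_k))` is bounded below. -/
theorem stmt16 {n : ℕ} (hn : 2 ≤ n) (a c₁ c₂ : ℝ) (ha : Real.sqrt ((n : ℝ) - 1) ≤ a)
    (hc₁ : 0 < c₁) (hc₁₂ : c₁ < c₂) (hc₂ : c₂ < 1)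
    (hτ : tauP n a c₁ = 0)
    (x : ℕ → EuclideanSpace ℝ (Fin n)) (t : ℕ → ℝ)
    (hx0 : 0 < |x 0 (firstIdx hn)|) (hx0a : |x 0 (firstIdx hn)| < a)
    (hxk : ∀ k, x k (firstIdx hn) ≠ 0)
    (hbr : ∀ k, a / 2 ^ ⌈Real.logb 2 (a / |x k (firstIdx hn)|)⌉ < |x k (firstIdx hn)| ∧
        |x k (firstIdx hn)| < a / 2 ^ (⌈Real.logb 2 (a / |x k (firstIdx hn)|)⌉ - 1))
    (ht : ∀ k, t k = 2 ^ (1 - ⌈Real.logb 2 (a / |x k (firstIdx hn)|)⌉))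
    (hstep : ∀ k, x (k + 1) = x k + t k • dir hn a (x k)) :
    (∃ xbar : EuclideanSpace ℝ (Fin n),
        Filter.Tendsto x Filter.atTop (nhds xbar) ∧ xbar (firstIdx hn) = 0) ∧
      BddBelow (Set.range fun k => objF hn a (x k)) := by
  have ha0 : 0 < a := lt_trans hx0 hx0a
  have htpos : ∀ k, 0 < t k := fun k => by rw [ht k]; positivity
  -- bracketing in terms of the step sizes
  have hlow : ∀ k, a * t k / 2 < |x k (firstIdx hn)| := by
    intro k
    have h := (hbr k).1
    rw [ht k, zpow_sub₀ (by norm_num), zpow_one]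
    refine lt_of_eq_of_lt ?_ h
    field_simp
  have hupp : ∀ k, |x k (firstIdx hn)| < a * t k := by
    intro k
    have h := (hbr k).2
    rw [ht k]
    refine lt_of_lt_of_eq h ?_
    rw [div_eq_mul_inv, ← zpow_neg, neg_sub]
  -- the first coordinate flips
  have hflip : ∀ k, |x (k + 1) (firstIdx hn)| = a * t k - |x k (firstIdx hn)| := by
    intro k
    have h1 : x (k + 1) (firstIdx hn)
        = x k (firstIdx hn) - t k * (Real.sign (x k (firstIdx hn)) * a) := by
      rw [hstep k]
      simp [dir, gradF]
      ring
    have hu := hupp k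
    rw [h1]
    rcases lt_or_gt_of_ne (hxk k) with h | h
    · rw [Real.sign_of_neg h]
      rw [abs_of_neg h] at hu ⊢
      rw [abs_of_pos (by linarith)]
      ring
    · rw [Real.sign_of_pos h]
      rw [abs_of_pos h] at hu ⊢
      rw [abs_of_neg (by linarith)]
      ring
  have hhalf : ∀ k, t (k + 1) ≤ t k / 2 := by
    intro k
    have h1 := hlow (k + 1)
    have h2 := hlow k
    rw [hflip k] at h1
    have h3 : t (k + 1) < t k := by
      have : a * t (k + 1) < a * t k := by linarith
      exact lt_of_mul_lt_mul_left this ha0.le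
    rw [ht k, ht (k + 1)] at h3 ⊢
    have h4 := (zpow_lt_zpow_iff_right₀ (by norm_num : (1 : ℝ) < 2)).1 h3
    have h5 : ∀ z : ℤ, (2 : ℝ) ^ z / 2 = 2 ^ (z - 1) := fun z => by
      rw [zpow_sub₀ (by norm_num), zpow_one]
    rw [h5]
    exact zpow_le_zpow_right₀ (by norm_num) (by omega)
  have hgeo : ∀ k, t k ≤ t 0 * (1 / 2) ^ k := by
    intro k
    induction k with
    | zero => simp
    | succ k ih =>
      have := hhalf k
      rw [pow_succ]
      linarith
  have ht0 : Filter.Tendsto t Filter.atTop (nhds 0) := by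
    refine squeeze_zero (fun k => (htpos k).le) hgeo ?_
    simpa using (tendsto_pow_atTop_nhds_zero_of_lt_one (by norm_num : (0 : ℝ) ≤ 1 / 2)
      (by norm_num)).const_mul (t 0)
  -- uniform bound on the direction
  obtain ⟨C, hC⟩ : ∃ C, ∀ k, ‖dir hn a (x k)‖ ≤ C := by
    let g : ℝ → EuclideanSpace ℝ (Fin n) := fun s =>
      (EuclideanSpace.equiv (Fin n) ℝ).symm (fun i => if i = firstIdx hn then s * a else 1)
    refine ⟨‖g 1‖ + ‖g (-1)‖, fun k => ?_⟩
    have h0 : ‖dir hn a (x k)‖ = ‖g (Real.sign (x k (firstIdx hn)))‖ := by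
      rw [dir, norm_neg]
      rfl
    rw [h0]
    rcases lt_or_gt_of_ne (hxk k) with h | h
    · rw [Real.sign_of_neg h]
      linarith [norm_nonneg (g 1)]
    · rw [Real.sign_of_pos h]
      linarith [norm_nonneg (g (-1))]
  have hC0 : 0 ≤ C := (norm_nonneg _).trans (hC 0)
  have hcau : CauchySeq x := by
    refine cauchySeq_of_le_geometric (1 / 2) (t 0 * C) (by norm_num) fun k => ?_
    rw [hstep k, dist_self_add_right, norm_smul, Real.norm_of_nonneg (htpos k).le]
    calc t k * ‖dir hn a (x k)‖ ≤ (t 0 * (1 / 2) ^ k) * C :=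
          mul_le_mul (hgeo k) (hC k) (norm_nonneg _) ((htpos k).le.trans (hgeo k))
      _ = _ := by ring
  obtain ⟨xbar, hxbar⟩ := cauchySeq_tendsto_of_complete hcau
  refine ⟨⟨xbar, hxbar, ?_⟩, ?_⟩
  · have hc : Continuous fun y : EuclideanSpace ℝ (Fin n) => y (firstIdx hn) := by fun_prop
    have h1 := (hc.tendsto xbar).comp hxbar
    have h2 : Filter.Tendsto (fun k => x k (firstIdx hn)) Filter.atTop (nhds 0) := by
      refine squeeze_zero_norm (fun k => (hupp k).le) ?_
      simpa using ht0.const_mul a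
    exact tendsto_nhds_unique h1 h2
  · have hc : Continuous (objF hn a) := by
      unfold objF
      fun_prop
    exact ((hc.tendsto xbar).comp hxbar).bddBelow_range
end

section
/- Suppose τ ≤ −1/2 and 0 < |x_0⁽¹⁾| < a, and suppose the gradient method is run so that for every k: x_k⁽¹⁾ ≠ 0, the strict bracketing (1 + τ)·a/2^{q_k} < |x_k⁽¹⁾| < (1 + τ)·a/2^{q_k−1} holds where q_k = ⌈log₂((1 + τ)·a/|x_k⁽¹⁾|)⌉, and t_k = min(1, 2^{1−q_k}). Then there exists K such that t_k = 1 for all k ≥ K, and f(x_k) → −∞ as k → ∞. -/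
lemma aux_climb (s : ℝ) (hs0 : 0 < s) (hs : s ≤ 1 / 2) (z t : ℕ → ℝ)
    (hz : ∀ k, z (k + 1) = |z k - t k|)
    (H : ∀ k, (t k = 1 ∧ s / 2 < z k) ∨
      (∃ m : ℕ, 1 ≤ m ∧ t k = (1 / 2) ^ m ∧ z k < s * t k)) (hz0 : ∀ k, 0 < z k) :
    ∀ m : ℕ, 1 ≤ m → ∀ k, t k = (1 / 2) ^ m → z k < s * t k →
      ∃ j, s / 2 < z j ∧ z j < 1 - s / 2 := by
  intro m
  induction m using Nat.strong_induction_on with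
  | _ m ih =>
    intro hm k hk hzk
    have htp : 0 < t k := by rw [hk]; positivity
    have hth : t k ≤ 1 / 2 := by
      rw [hk]
      calc ((1 : ℝ) / 2) ^ m ≤ (1 / 2) ^ 1 :=
            pow_le_pow_of_le_one (by norm_num) (by norm_num) hm
        _ = 1 / 2 := by norm_num
    have hst : s * t k ≤ t k / 2 := by nlinarith
    have hz1 : z (k + 1) = t k - z k := by
      rw [hz, abs_sub_comm, abs_of_nonneg]; linarith
    have hp := hz0 k
    rcases H (k + 1) with ⟨h1, h2⟩ | ⟨m', hm', h1, h2⟩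
    · exact ⟨k + 1, h2, by linarith⟩
    · have hlt : s * t k < s * t (k + 1) := by linarith
      have hlt' : t k < t (k + 1) := lt_of_mul_lt_mul_left hlt hs0.le
      rw [hk, h1] at hlt'
      have : m' < m := (pow_lt_pow_iff_right_of_lt_one₀ (by norm_num) (by norm_num)).1 hlt'
      exact ih m' this hm' (k + 1) h1 h2

lemma aux_dyn (s : ℝ) (hs0 : 0 < s) (hs : s ≤ 1 / 2) (z t : ℕ → ℝ)
    (hz : ∀ k, z (k + 1) = |z k - t k|)
    (H : ∀ k, (t k = 1 ∧ s / 2 < z k) ∨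
      (∃ m : ℕ, 1 ≤ m ∧ t k = (1 / 2) ^ m ∧ z k < s * t k)) (hz0 : ∀ k, 0 < z k)
    (hz01 : z 0 < 1) :
    ∃ K, ∀ k, K ≤ k → t k = 1 ∧ s / 2 < z k ∧ z k < 1 - s / 2 := by
  have key : ∃ j, s / 2 < z j ∧ z j < 1 - s / 2 := by
    rcases H 0 with ⟨h1, h2⟩ | ⟨m, hm, h1, h2⟩
    · by_cases hc : z 0 < 1 - s / 2
      · exact ⟨0, h2, hc⟩
      · have h3 : z 1 = 1 - z 0 := by
          rw [hz 0, h1, abs_sub_comm, abs_of_nonneg]; linarith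
        rcases H 1 with ⟨g1, g2⟩ | ⟨m, hm, g1, g2⟩
        · linarith
        · exact aux_climb s hs0 hs z t hz H hz0 m hm 1 g1 g2
    · exact aux_climb s hs0 hs z t hz H hz0 m hm 0 h1 h2
  have one : ∀ k, s / 2 < z k → t k = 1 := by
    intro k hk
    rcases H k with ⟨h1, h2⟩ | ⟨m, hm, h1, h2⟩
    · exact h1
    · have hth : t k ≤ 1 / 2 := by
        rw [h1]
        calc ((1 : ℝ) / 2) ^ m ≤ (1 / 2) ^ 1 :=
              pow_le_pow_of_le_one (by norm_num) (by norm_num) hm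
          _ = 1 / 2 := by norm_num
      nlinarith
  obtain ⟨K, hK⟩ := key
  have inv : ∀ k, K ≤ k → s / 2 < z k ∧ z k < 1 - s / 2 := by
    intro k hk
    induction k, hk using Nat.le_induction with
    | base => exact hK
    | succ k hk ih =>
      have h3 : z (k + 1) = 1 - z k := by
        rw [hz k, one k ih.1, abs_sub_comm, abs_of_nonneg]; linarith
      constructor <;> linarith [ih.1, ih.2]
  exact ⟨K, fun k hk => ⟨one k (inv k hk).1, inv k hk⟩⟩

lemma aux_state (s a y : ℝ) (q : ℤ) (t : ℝ) (ha : 0 < a) (hs0 : 0 < s)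
    (h1 : s * a / 2 ^ q < y) (h2 : y < s * a / 2 ^ (q - 1))
    (ht : t = min 1 (2 ^ (1 - q))) :
    (t = 1 ∧ s / 2 < y / a) ∨ (∃ m : ℕ, 1 ≤ m ∧ t = (1 / 2) ^ m ∧ y / a < s * t) := by
  by_cases hq : q ≤ 1
  · left
    constructor
    · rw [ht]
      exact min_eq_left (one_le_zpow₀ (by norm_num) (by omega))
    · rw [lt_div_iff₀ ha]
      refine lt_of_le_of_lt ?_ h1
      have h3 : (2 : ℝ) ^ q ≤ 2 := by
        calc (2 : ℝ) ^ q ≤ 2 ^ (1 : ℤ) := zpow_le_zpow_right₀ (by norm_num) hq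
          _ = 2 := by norm_num
      have h4 : s * a / 2 ≤ s * a / 2 ^ q :=
        div_le_div_of_nonneg_left (by positivity) (by positivity) h3
      linarith
  · right
    obtain ⟨m, hm⟩ : ∃ m : ℕ, q - 1 = (m : ℤ) := ⟨(q - 1).toNat, by omega⟩
    have e : (2 : ℝ) ^ (1 - q) = (1 / 2) ^ m := by
      rw [show 1 - q = -(m : ℤ) by omega, zpow_neg, zpow_natCast]; simp
    have ht' : t = (1 / 2) ^ m := by
      rw [ht, e]
      exact min_eq_right (pow_le_one₀ (by norm_num) (by norm_num))
    refine ⟨m, by omega, ht', ?_⟩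
    rw [div_lt_iff₀ ha, ht']
    rw [hm, zpow_natCast] at h2
    calc y < _ := h2
      _ = _ := by rw [one_div, inv_pow]; ring

/-- suppose `τ ≤ −1/2`, `0 < |x_0⁽¹⁾| < a`, and at every iteration
`(1 + τ)·a/2^(q_k) < |x_k⁽¹⁾| < (1 + τ)·a/2^(q_k−1)` with
`q_k = ⌈log₂((1 + τ)·a/|x_k⁽¹⁾|)⌉` and `t_k = min(1, 2^(1−q_k))`. Then eventually `t_k = 1`
at every iteration, and `f(x_k) → −∞`. -/
theorem stmt18 {n : ℕ} (hn : 2 ≤ n) (a c₁ c₂ : ℝ) (ha : Real.sqrt ((n : ℝ) - 1) ≤ a)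
    (hc₁ : 0 < c₁) (hc₁₂ : c₁ < c₂) (hc₂ : c₂ < 1)
    (hτ : tauP n a c₁ ≤ -(1 / 2))
    (x : ℕ → EuclideanSpace ℝ (Fin n)) (t : ℕ → ℝ)
    (hx0 : 0 < |x 0 (firstIdx hn)|) (hx0a : |x 0 (firstIdx hn)| < a)
    (hxk : ∀ k, x k (firstIdx hn) ≠ 0)
    (hbr : ∀ k,
        (1 + tauP n a c₁) * a /
            2 ^ ⌈Real.logb 2 ((1 + tauP n a c₁) * a / |x k (firstIdx hn)|)⌉ <
          |x k (firstIdx hn)| ∧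
        |x k (firstIdx hn)| <
          (1 + tauP n a c₁) * a /
            2 ^ (⌈Real.logb 2 ((1 + tauP n a c₁) * a / |x k (firstIdx hn)|)⌉ - 1))
    (ht : ∀ k, t k =
        min 1 (2 ^ (1 - ⌈Real.logb 2 ((1 + tauP n a c₁) * a / |x k (firstIdx hn)|)⌉)))
    (hstep : ∀ k, x (k + 1) = x k + t k • dir hn a (x k)) :
    (∃ K : ℕ, ∀ k, K ≤ k → t k = 1) ∧
      Filter.Tendsto (fun k => objF hn a (x k)) Filter.atTop Filter.atBot := by
  have hn2 : (2 : ℝ) ≤ n := by exact_mod_cast hn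
  have hapos : 0 < a := lt_of_lt_of_le (Real.sqrt_pos.2 (by linarith)) ha
  have hasq : (n : ℝ) - 1 ≤ a ^ 2 := (Real.sqrt_le_left hapos.le).1 ha
  have hs0 : 0 < 1 + tauP n a c₁ := by
    unfold tauP
    have h1 : -(1 - c₁) ≤ ((n : ℝ) - 1) * (c₁ - 1) / a ^ 2 := by
      rw [le_div_iff₀ (by positivity)]
      nlinarith
    linarith
  set s := 1 + tauP n a c₁ with hs_def
  have hs : s ≤ 1 / 2 := by linarith
  have hfirst : ∀ k, |x (k + 1) (firstIdx hn)| = |(|x k (firstIdx hn)| - a * t k)| := by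
    intro k
    have e : x (k + 1) (firstIdx hn) =
        x k (firstIdx hn) - t k * (Real.sign (x k (firstIdx hn)) * a) := by
      rw [hstep k]; simp [dir, gradF]; ring
    rw [e]
    rcases lt_or_gt_of_ne (hxk k) with h | h
    · rw [Real.sign_of_neg h, abs_of_neg h, ← abs_neg]; congr 1; ring
    · rw [Real.sign_of_pos h, abs_of_pos h]; congr 1; ring
  have hrest : ∀ k, ∑ i ∈ Finset.univ.erase (firstIdx hn), x (k + 1) i =
      (∑ i ∈ Finset.univ.erase (firstIdx hn), x k i) - ((n : ℝ) - 1) * t k := by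
    intro k
    have e : ∀ i ∈ Finset.univ.erase (firstIdx hn), x (k + 1) i = x k i - t k := by
      intro i hi
      have hi' : i ≠ firstIdx hn := Finset.ne_of_mem_erase hi
      rw [hstep k]; simp [dir, gradF, hi']; ring
    rw [Finset.sum_congr rfl e, Finset.sum_sub_distrib, Finset.sum_const,
      Finset.card_erase_of_mem (Finset.mem_univ _), Finset.card_univ, Fintype.card_fin,
      nsmul_eq_mul, Nat.cast_sub (by omega)]
    simp
  obtain ⟨K, hK⟩ := aux_dyn s hs0 hs (fun k => |x k (firstIdx hn)| / a) t
    (by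
      intro k
      show |x (k + 1) (firstIdx hn)| / a = |(|x k (firstIdx hn)| / a - t k)|
      have e : |x k (firstIdx hn)| / a - t k = (|x k (firstIdx hn)| - a * t k) / a := by
        field_simp
      rw [hfirst k, e, abs_div, abs_of_pos hapos])
    (fun k => aux_state s a _ _ (t k) hapos hs0 (hbr k).1 (hbr k).2 (ht k))
    (fun k => div_pos (abs_pos.2 (hxk k)) hapos)
    ((div_lt_one hapos).2 hx0a)
  refine ⟨⟨K, fun k hk => (hK k hk).1⟩, ?_⟩
  set S : ℕ → ℝ := fun k => ∑ i ∈ Finset.univ.erase (firstIdx hn), x k i with hS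
  have hSK : ∀ j : ℕ, S (K + j) = S K - ((n : ℝ) - 1) * j := by
    intro j
    induction j with
    | zero => simp
    | succ j ih =>
      have := hrest (K + j)
      rw [(hK (K + j) (by omega)).1] at this
      change S (K + j + 1) = S (K + j) - _ at this
      rw [← add_assoc, this, ih]; push_cast; ring
  rw [← Filter.tendsto_add_atTop_iff_nat K]
  have hlim : Filter.Tendsto (fun j : ℕ => (a * a + S K) + -(j : ℝ)) Filter.atTop
      Filter.atBot :=
    Filter.tendsto_atBot_add_const_left _ _
      (Filter.tendsto_neg_atTop_atBot.comp tendsto_natCast_atTop_atTop)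
  refine Filter.tendsto_atBot_mono (fun j => ?_) hlim
  have h1 := (hK (K + j) (by omega)).2.2
  have h2 : |x (K + j) (firstIdx hn)| < a := by
    have h3 : |x (K + j) (firstIdx hn)| / a < 1 := by
      have : |x (K + j) (firstIdx hn)| / a < 1 - s / 2 := h1
      linarith
    exact (div_lt_one hapos).1 h3
  have h4 : objF hn a (x (j + K)) = a * |x (K + j) (firstIdx hn)| + S (K + j) := by
    rw [add_comm j K]; rfl
  rw [h4, hSK j]
  have hj : (0 : ℝ) ≤ j := Nat.cast_nonneg j
  nlinarith
end
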